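/- Fix s > 0, τ > 0 and r ≥ 0, and define the Black–Scholes call and put price functions of strike K > 0 and volatility σ > 0 by C^{BS}(K,σ) = s·Φ(d₁) − K·e^{−rτ}·Φ(d₂) and P^{BS}(K,σ) = K·e^{−rτ}·Φ(−d₂) − s·Φ(−d₁), where d₁ = (log(s/K) + (r + σ²/2)τ)/(σ√τ) and d₂ = d₁ − σ√τ. Let σ̂ : (0,∞) → (0,∞) be a differentiable implied-volatility curve. If the function K ↦ C^{BS}(K, σ̂(K)) is nonincreasing, then for every K > 0, σ̂′(K) ≤ e^{−rτ}·Φ(d₂)/(s·√τ·φ(d₁)), with d₁, d₂ evaluated at (K, σ̂(K)). If moreover K ↦ P^{BS}(K, σ̂(K)) is nondecreasing, then σ̂′(K) ≥ −e^{−rτ}·Φ(−d₂)/(s·√τ·φ(d₁)). -/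

import Mathlib

open Real MeasureTheory Set

/-- The standard normal cumulative distribution function. -/
noncomputable def Phi (x : ℝ) : ℝ :=
  (Real.sqrt (2 * Real.pi))⁻¹ * ∫ y in Set.Iio x, Real.exp (-(y ^ 2) / 2)

/-- The standard normal probability density function. -/
noncomputable def phi (x : ℝ) : ℝ :=
  (Real.sqrt (2 * Real.pi))⁻¹ * Real.exp (-(x ^ 2) / 2)

/-- `d₁` of the Black–Scholes formula as a function of strike `K` and volatility `σv`. -/
noncomputable def d1 (s τ r K σv : ℝ) : ℝ :=
  (Real.log (s / K) + (r + σv ^ 2 / 2) * τ) / (σv * Real.sqrt τ)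

/-- `d₂` of the Black–Scholes formula as a function of strike `K` and volatility `σv`. -/
noncomputable def d2 (s τ r K σv : ℝ) : ℝ :=
  d1 s τ r K σv - σv * Real.sqrt τ

/-- The Black–Scholes call price as a function of strike `K` and volatility `σv`. -/
noncomputable def callBS (s τ r K σv : ℝ) : ℝ :=
  s * Phi (d1 s τ r K σv) - K * Real.exp (-r * τ) * Phi (d2 s τ r K σv)

/-- The Black–Scholes put price as a function of strike `K` and volatility `σv`. -/
noncomputable def putBS (s τ r K σv : ℝ) : ℝ :=
  K * Real.exp (-r * τ) * Phi (-(d2 s τ r K σv)) - s * Phi (-(d1 s τ r K σv))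

lemma integrable_exp_neg_sq_div_two :
    Integrable (fun y : ℝ => Real.exp (-(y ^ 2) / 2)) := by
  have h := integrable_exp_neg_mul_sq (b := 1 / 2) (by norm_num)
  refine h.congr (Filter.Eventually.of_forall fun y => ?_)
  simp only
  congr 1
  ring

lemma phi_pos (x : ℝ) : 0 < phi x := by
  unfold phi
  positivity

lemma phi_neg (x : ℝ) : phi (-x) = phi x := by
  simp [phi]

lemma hasDerivAt_Phi (x : ℝ) : HasDerivAt Phi (phi x) x := by
  have hcont : Continuous fun y : ℝ => Real.exp (-(y ^ 2) / 2) := by fun_prop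
  have hPhi : Phi = fun z => (Real.sqrt (2 * Real.pi))⁻¹ *
      ((∫ y in Set.Iic 0, Real.exp (-(y ^ 2) / 2)) + ∫ y in (0 : ℝ)..z, Real.exp (-(y ^ 2) / 2)) := by
    funext z
    rw [Phi, ← integral_Iic_eq_integral_Iio, ← intervalIntegral.integral_Iic_sub_Iic
      integrable_exp_neg_sq_div_two.integrableOn integrable_exp_neg_sq_div_two.integrableOn]
    ring
  rw [hPhi]
  exact ((hcont.integral_hasStrictDerivAt 0 x).hasDerivAt.const_add _).const_mul _

lemma mul_phi_d1_eq_mul_phi_d2 {s τ K σv : ℝ} (r : ℝ) (hs : 0 < s) (hτ : 0 < τ) (hK : 0 < K)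
    (hσ : 0 < σv) :
    K * Real.exp (-r * τ) * phi (d2 s τ r K σv) = s * phi (d1 s τ r K σv) := by
  have hmul : d1 s τ r K σv * (σv * Real.sqrt τ) =
      Real.log s - Real.log K + (r + σv ^ 2 / 2) * τ := by
    rw [d1, Real.log_div hs.ne' hK.ne']
    exact div_mul_cancel₀ _ (by positivity)
  have hsq : Real.sqrt τ ^ 2 = τ := Real.sq_sqrt hτ.le
  have hexp : Real.log K + -r * τ + -(d2 s τ r K σv ^ 2) / 2 =
      Real.log s + -(d1 s τ r K σv ^ 2) / 2 := by
    rw [d2]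
    linear_combination hmul - σv ^ 2 / 2 * hsq
  have h := congrArg Real.exp hexp
  rw [Real.exp_add, Real.exp_add, Real.exp_add, Real.exp_log hs, Real.exp_log hK] at h
  rw [phi, phi]
  linear_combination (Real.sqrt (2 * Real.pi))⁻¹ * h

section Curve

variable {s τ r K : ℝ} {σhat : ℝ → ℝ}

lemma differentiableAt_d1_comp (hs : 0 < s) (hτ : 0 < τ) (hK : 0 < K) (hσ : 0 < σhat K)
    (hdiff : DifferentiableAt ℝ σhat K) :
    DifferentiableAt ℝ (fun k => d1 s τ r k (σhat k)) K := by
  have hK' : K ≠ 0 := hK.ne'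
  have hsK : s / K ≠ 0 := by positivity
  have hden : σhat K * Real.sqrt τ ≠ 0 := by positivity
  unfold d1
  fun_prop (disch := assumption)

lemma hasDerivAt_callBS_comp (hs : 0 < s) (hτ : 0 < τ) (hK : 0 < K) (hσ : 0 < σhat K)
    (hdiff : DifferentiableAt ℝ σhat K) :
    HasDerivAt (fun k => callBS s τ r k (σhat k))
      (s * Real.sqrt τ * phi (d1 s τ r K (σhat K)) * deriv σhat K -
        Real.exp (-r * τ) * Phi (d2 s τ r K (σhat K))) K := by
  have h1 := (differentiableAt_d1_comp (r := r) hs hτ hK hσ hdiff).hasDerivAt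
  have h2 : HasDerivAt (fun k => d2 s τ r k (σhat k)) _ K :=
    h1.sub (hdiff.hasDerivAt.mul_const (Real.sqrt τ))
  have h := (((hasDerivAt_Phi _).comp K h1).const_mul s).sub
    (((hasDerivAt_id K).mul_const (Real.exp (-r * τ))).mul ((hasDerivAt_Phi _).comp K h2))
  refine h.congr_deriv ?_
  simp only [id, Function.comp_apply]
  linear_combination (deriv σhat K * Real.sqrt τ - deriv (fun k => d1 s τ r k (σhat k)) K) *
    mul_phi_d1_eq_mul_phi_d2 r hs hτ hK hσ

lemma hasDerivAt_putBS_comp (hs : 0 < s) (hτ : 0 < τ) (hK : 0 < K) (hσ : 0 < σhat K)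
    (hdiff : DifferentiableAt ℝ σhat K) :
    HasDerivAt (fun k => putBS s τ r k (σhat k))
      (s * Real.sqrt τ * phi (d1 s τ r K (σhat K)) * deriv σhat K +
        Real.exp (-r * τ) * Phi (-(d2 s τ r K (σhat K)))) K := by
  have h1 := (differentiableAt_d1_comp (r := r) hs hτ hK hσ hdiff).hasDerivAt
  have h2 : HasDerivAt (fun k => d2 s τ r k (σhat k)) _ K :=
    h1.sub (hdiff.hasDerivAt.mul_const (Real.sqrt τ))
  have h := (((hasDerivAt_id K).mul_const (Real.exp (-r * τ))).mul
    ((hasDerivAt_Phi _).comp K h2.neg)).sub (((hasDerivAt_Phi _).comp K h1.neg).const_mul s)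
  refine h.congr_deriv ?_
  simp only [id, Function.comp_apply, Pi.neg_apply, phi_neg]
  linear_combination (deriv σhat K * Real.sqrt τ - deriv (fun k => d1 s τ r k (σhat k)) K) *
    mul_phi_d1_eq_mul_phi_d2 r hs hτ hK hσ

end Curve

/-- Bounds on the slope of a differentiable implied-volatility curve: if the market call
prices `K ↦ C^{BS}(K, σ̂(K))` are nonincreasing in strike then
`σ̂′(K) ≤ e^{−rτ}·Φ(d₂)/(s√τ·φ(d₁))`; if moreover the market put prices
`K ↦ P^{BS}(K, σ̂(K))` are nondecreasing then
`σ̂′(K) ≥ −e^{−rτ}·Φ(−d₂)/(s√τ·φ(d₁))`. -/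
theorem implied_volatility_slope_bounds
    (s τ r : ℝ) (hs : 0 < s) (hτ : 0 < τ) (hr : 0 ≤ r)
    (σhat : ℝ → ℝ) (hσhat_pos : ∀ K > 0, 0 < σhat K)
    (hσhat_diff : ∀ K > 0, DifferentiableAt ℝ σhat K)
    (hcall : AntitoneOn (fun K => callBS s τ r K (σhat K)) (Set.Ioi 0)) :
    (∀ K > 0, deriv σhat K
        ≤ Real.exp (-r * τ) * Phi (d2 s τ r K (σhat K)) /
            (s * Real.sqrt τ * phi (d1 s τ r K (σhat K)))) ∧
    (MonotoneOn (fun K => putBS s τ r K (σhat K)) (Set.Ioi 0) →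
      ∀ K > 0,
        -(Real.exp (-r * τ) * Phi (-(d2 s τ r K (σhat K))) /
            (s * Real.sqrt τ * phi (d1 s τ r K (σhat K)))) ≤ deriv σhat K) := by
  have hvega : ∀ K, 0 < s * Real.sqrt τ * phi (d1 s τ r K (σhat K)) := fun K =>
    mul_pos (by positivity) (phi_pos _)
  refine ⟨fun K hK => ?_, fun hput K hK => ?_⟩
  · have hd := hasDerivAt_callBS_comp (r := r) hs hτ hK (hσhat_pos K hK) (hσhat_diff K hK)
    have h := hcall.derivWithin_nonpos (x := K)
    rw [derivWithin_of_isOpen isOpen_Ioi hK, hd.deriv] at h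
    rw [le_div_iff₀ (hvega K)]
    linarith
  · have hd := hasDerivAt_putBS_comp (r := r) hs hτ hK (hσhat_pos K hK) (hσhat_diff K hK)
    have h := hput.derivWithin_nonneg (x := K)
    rw [derivWithin_of_isOpen isOpen_Ioi hK, hd.deriv] at h
    rw [← neg_div, div_le_iff₀ (hvega K)]
    linarith
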